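/- arXiv:1211.2641 — 3 statements merged into one kernel-verified Lean document; each statement's English description precedes it below -/
import Mathlib

section
/- Let x₁, x₂, …, x_m, a, b, c, d be positive integers with a ≤ b ≤ c ≤ d, and define the multisets S = {x₁, …, x_m, a+b, a+b, c+d, c+d}, T = {x₁, …, x_m, a+c, a+c, b+d, b+d}, and U = {x₁, …, x_m, a+d, a+d, b+c, b+c}. Then for every integer k ≥ 0, opt(S,k) ≤ opt(T,k) and opt(S,k) ≤ opt(U,k). -/
/-- One move of the game: choose two elements `a` and `b` of the current configuration
(counted with multiplicity) and replace both of them by `a + b`. -/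
def GameMove (S T : Multiset ℕ) : Prop :=
  ∃ (a b : ℕ) (S' : Multiset ℕ),
    S = a ::ₘ b ::ₘ S' ∧ T = (a + b) ::ₘ (a + b) ::ₘ S'

/-- `ReachIn k S T` means the configuration `T` can be obtained from `S` by exactly
`k` moves of the game. -/
def ReachIn : ℕ → Multiset ℕ → Multiset ℕ → Prop
  | 0 => fun S T => T = S
  | k + 1 => fun S T => ∃ U : Multiset ℕ, GameMove S U ∧ ReachIn k U T

/-- `opt S k` is the smallest possible sum of a configuration obtainable from the
starting configuration `S` after exactly `k` moves. -/
noncomputable def opt (S : Multiset ℕ) (k : ℕ) : ℕ :=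
  sInf {s : ℕ | ∃ T : Multiset ℕ, ReachIn k S T ∧ T.sum = s}

/-- A play on a linear image of a multiset `M` lifts to the labels, and can then be replayed on
every other linear image of `M`. -/
theorem ReachIn.exists_lift {G : Type*} [AddCommMonoid G] [DecidableEq G] (f : G →+ ℕ) :
    ∀ (k : ℕ) (M : Multiset G) (T : Multiset ℕ), ReachIn k (M.map f) T →
      ∃ N : Multiset G, T = N.map f ∧ ∀ g : G →+ ℕ, ReachIn k (M.map g) (N.map g)
  | 0, M, _, h => ⟨M, h, fun _ => rfl⟩
  | k + 1, M, T, ⟨U, ⟨a, b, S', hM, hU⟩, hT⟩ => by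
    obtain ⟨x, hx, rfl, h1⟩ := (Multiset.map_eq_cons f M (b ::ₘ S') a).2 hM
    obtain ⟨M', rfl⟩ := Multiset.exists_cons_of_mem hx
    rw [Multiset.erase_cons_head] at h1
    obtain ⟨y, hy, rfl, h2⟩ := (Multiset.map_eq_cons f M' S' b).2 h1
    obtain ⟨M'', rfl⟩ := Multiset.exists_cons_of_mem hy
    rw [Multiset.erase_cons_head] at h2
    subst h2
    have hU' : U = ((x + y) ::ₘ (x + y) ::ₘ M'').map f := by simp [hU]
    rw [hU'] at hT
    obtain ⟨N, hN, hg⟩ := ReachIn.exists_lift f k _ T hT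
    exact ⟨N, hN, fun g => ⟨_, ⟨g x, g y, M''.map g, by simp, by simp⟩, hg g⟩⟩

/-- From a configuration with at least two elements one can make any number of moves. -/
theorem ReachIn.exists_of_cons_cons :
    ∀ (k a b : ℕ) (S : Multiset ℕ), ∃ T, ReachIn k (a ::ₘ b ::ₘ S) T
  | 0, _, _, _ => ⟨_, rfl⟩
  | k + 1, a, b, S => by
    obtain ⟨T, hT⟩ := ReachIn.exists_of_cons_cons k (a + b) (a + b) S
    exact ⟨T, _, ⟨a, b, S, rfl, rfl⟩, hT⟩

theorem opt_le_sum {k : ℕ} {S T : Multiset ℕ} (h : ReachIn k S T) : opt S k ≤ T.sum :=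
  Nat.sInf_le ⟨T, h, rfl⟩

theorem exists_reachIn_sum_eq_opt (k a b : ℕ) (S : Multiset ℕ) :
    ∃ T, ReachIn k (a ::ₘ b ::ₘ S) T ∧ T.sum = opt (a ::ₘ b ::ₘ S) k := by
  obtain ⟨T, hT⟩ := ReachIn.exists_of_cons_cons k a b S
  exact Nat.sInf_mem (s := {s | ∃ T, ReachIn k (a ::ₘ b ::ₘ S) T ∧ T.sum = s}) ⟨_, T, hT, rfl⟩

/-- The linear form `(p, q, r) ↦ p * u + q * v + r`. -/
def pairForm (u v : ℕ) : ℕ × ℕ × ℕ →+ ℕ where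
  toFun z := z.1 * u + z.2.1 * v + z.2.2
  map_zero' := by simp
  map_add' x y := by simp only [Prod.fst_add, Prod.snd_add]; ring

/-- An optimal play with two doubled entries `u`, `v` yields an affine upper bound for all values
of the doubled entries, attained at `u`, `v`. -/
theorem exists_affine_bound_opt (X : Multiset ℕ) (k u v : ℕ) :
    ∃ p q r : ℕ, opt (u ::ₘ u ::ₘ v ::ₘ v ::ₘ X) k = p * u + q * v + r ∧
      ∀ u' v' : ℕ, opt (u' ::ₘ u' ::ₘ v' ::ₘ v' ::ₘ X) k ≤ p * u' + q * v' + r := by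
  let M : Multiset (ℕ × ℕ × ℕ) :=
    (1, 0, 0) ::ₘ (1, 0, 0) ::ₘ (0, 1, 0) ::ₘ (0, 1, 0) ::ₘ X.map fun x => (0, 0, x)
  have hM (u v : ℕ) : M.map (pairForm u v) = u ::ₘ u ::ₘ v ::ₘ v ::ₘ X := by
    simp [M, pairForm]
  obtain ⟨T, hT, hsum⟩ := exists_reachIn_sum_eq_opt k u u (v ::ₘ v ::ₘ X)
  rw [← hM u v] at hT
  obtain ⟨N, rfl, hN⟩ := ReachIn.exists_lift _ k M T hT
  refine ⟨N.sum.1, N.sum.2.1, N.sum.2.2, ?_, fun u' v' => ?_⟩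
  · rw [← hsum, ← map_multiset_sum]
    rfl
  · have h := opt_le_sum (hN (pairForm u' v'))
    rw [hM, ← map_multiset_sum] at h
    exact h

theorem opt_doubled_swap (X : Multiset ℕ) (k u v : ℕ) :
    opt (u ::ₘ u ::ₘ v ::ₘ v ::ₘ X) k = opt (v ::ₘ v ::ₘ u ::ₘ u ::ₘ X) k := by
  congr 1
  simp only [← Multiset.singleton_add]
  abel

/-- Spreading the two doubled entries further apart, at constant total, does not increase `opt`. -/
theorem opt_doubled_le_of_spread (X : Multiset ℕ) (k : ℕ) {s t u v : ℕ}
    (hsum : s + t = u + v) (hu : s ≤ u) (hv : s ≤ v) :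
    opt (s ::ₘ s ::ₘ t ::ₘ t ::ₘ X) k ≤ opt (u ::ₘ u ::ₘ v ::ₘ v ::ₘ X) k := by
  obtain ⟨p, q, r, heq, hle⟩ := exists_affine_bound_opt X k u v
  obtain ⟨e, rfl⟩ := Nat.exists_eq_add_of_le hu
  obtain ⟨e', rfl⟩ := Nat.exists_eq_add_of_le hv
  obtain rfl : t = s + e + e' := by omega
  rw [heq]
  rcases le_total q p with h | h
  · exact (hle _ _).trans (by nlinarith [Nat.mul_le_mul_right e h])
  · rw [opt_doubled_swap]
    exact (hle _ _).trans (by nlinarith [Nat.mul_le_mul_right e' h])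

/-- Let `x₁, …, x_m, a, b, c, d` be positive integers with `a ≤ b ≤ c ≤ d`, and set
`S = {x₁, …, x_m, a+b, a+b, c+d, c+d}`, `T = {x₁, …, x_m, a+c, a+c, b+d, b+d}`, and
`U = {x₁, …, x_m, a+d, a+d, b+c, b+c}`.  Then for every `k ≥ 0` we have
`opt S k ≤ opt T k` and `opt S k ≤ opt U k`. -/
theorem opt_pairing_le (X : Multiset ℕ) (hX : ∀ x ∈ X, 0 < x)
    (a b c d : ℕ) (ha : 0 < a) (hab : a ≤ b) (hbc : b ≤ c) (hcd : c ≤ d) (k : ℕ) :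
    opt ((a + b) ::ₘ (a + b) ::ₘ (c + d) ::ₘ (c + d) ::ₘ X) k
        ≤ opt ((a + c) ::ₘ (a + c) ::ₘ (b + d) ::ₘ (b + d) ::ₘ X) k ∧
    opt ((a + b) ::ₘ (a + b) ::ₘ (c + d) ::ₘ (c + d) ::ₘ X) k
        ≤ opt ((a + d) ::ₘ (a + d) ::ₘ (b + c) ::ₘ (b + c) ::ₘ X) k := by
  exact ⟨opt_doubled_le_of_spread X k (by omega) (by omega) (by omega),
    opt_doubled_le_of_spread X k (by omega) (by omega) (by omega)⟩
end

section
/- Let k ≥ 1 and let S = {s₁, s₂, …, s_n} be a starting configuration with s₁ ≤ s₂ ≤ … ≤ s_n. Let S′ = {s₁+s₂, s₁+s₂, s₃, …, s_n} be the configuration obtained by performing the move (s₁, s₂). Then opt(S′, k−1) = opt(S, k); that is, there exists an optimal k-step strategy whose first move combines the two smallest elements. -/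
/-- One move of the game played with elements of an arbitrary additive structure. -/
def GenMove {A : Type*} [Add A] (S T : Multiset A) : Prop :=
  ∃ (a b : A) (S' : Multiset A),
    S = a ::ₘ b ::ₘ S' ∧ T = (a + b) ::ₘ (a + b) ::ₘ S'

/-- Reachability in exactly `k` moves of the generalized game. -/
def GenReach {A : Type*} [Add A] : ℕ → Multiset A → Multiset A → Prop
  | 0 => fun S T => T = S
  | k + 1 => fun S T => ∃ U : Multiset A, GenMove S U ∧ GenReach k U T

theorem Multiset.exists_cons_of_map_eq_cons {A B : Type*} {f : A → B} {M : Multiset A} {b : B}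
    {S : Multiset B} (h : M.map f = b ::ₘ S) : ∃ a N, M = a ::ₘ N ∧ f a = b ∧ N.map f = S := by
  have hb : b ∈ M.map f := by rw [h]; exact Multiset.mem_cons_self b S
  obtain ⟨a, ha, rfl⟩ := Multiset.mem_map.1 hb
  obtain ⟨N, rfl⟩ := Multiset.exists_cons_of_mem ha
  refine ⟨a, N, rfl, rfl, ?_⟩
  rw [Multiset.map_cons] at h
  exact (Multiset.cons_inj_right _).1 h

theorem GenReach.map {A : Type*} [AddCommMonoid A] (f : A →+ ℕ) {k : ℕ} {M N : Multiset A}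
    (h : GenReach k M N) : ReachIn k (M.map f) (N.map f) := by
  induction k generalizing M with
  | zero => exact congrArg (Multiset.map f) h
  | succ k ih =>
    obtain ⟨U, ⟨a, b, S, rfl, rfl⟩, hU⟩ := h
    exact ⟨_, ⟨f a, f b, S.map f, by simp, by simp⟩, ih hU⟩

theorem ReachIn.exists_genReach {A : Type*} [AddCommMonoid A] (f : A →+ ℕ) {k : ℕ}
    {M : Multiset A} {T : Multiset ℕ} (h : ReachIn k (M.map f) T) :
    ∃ N, GenReach k M N ∧ N.map f = T := by
  induction k generalizing M with
  | zero => exact ⟨M, rfl, h.symm⟩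
  | succ k ih =>
    obtain ⟨U, ⟨a, b, S, hS, rfl⟩, hU⟩ := h
    obtain ⟨a, M, rfl, rfl, hM⟩ := Multiset.exists_cons_of_map_eq_cons hS
    obtain ⟨b, M, rfl, rfl, rfl⟩ := Multiset.exists_cons_of_map_eq_cons hM
    obtain ⟨N, hN, hNT⟩ := ih (M := (a + b) ::ₘ (a + b) ::ₘ M) (by simpa using hU)
    exact ⟨N, ⟨_, ⟨a, b, M, rfl, rfl⟩, hN⟩, hNT⟩

/-- Evaluation of the formal expression `i * u + j * v + r`. -/
def evalPair (u v : ℕ) : ℕ × ℕ × ℕ →+ ℕ where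
  toFun p := p.1 * u + p.2.1 * v + p.2.2
  map_zero' := by simp
  map_add' p q := by simp only [Prod.fst_add, Prod.snd_add]; ring

theorem map_evalPair (u v : ℕ) (R : Multiset ℕ) :
    ((1, 0, 0) ::ₘ (0, 1, 0) ::ₘ R.map (fun r => ((0, 0, r) : ℕ × ℕ × ℕ))).map (evalPair u v)
      = u ::ₘ v ::ₘ R := by
  simp [evalPair]

/-- Lowering one of two elements below both and not increasing their sum does not increase the
attainable sums. -/
theorem ReachIn.exists_sum_le {k u v u' v' : ℕ} {R T : Multiset ℕ}
    (h : ReachIn k (u' ::ₘ v' ::ₘ R) T) (hu : u ≤ u') (hv : u ≤ v') (huv : u + v ≤ u' + v') :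
    ∃ T', ReachIn k (u ::ₘ v ::ₘ R) T' ∧ T'.sum ≤ T.sum := by
  rw [← map_evalPair u' v' R] at h
  obtain ⟨N, hN, rfl⟩ := h.exists_genReach
  have h₁ := hN.map (evalPair u v)
  have h₂ := hN.map (evalPair v u)
  rw [map_evalPair] at h₁ h₂
  rw [Multiset.cons_swap] at h₂
  have hsum (x y : ℕ) : (N.map (evalPair x y)).sum
      = N.sum.1 * x + N.sum.2.1 * y + N.sum.2.2 := (map_multiset_sum (evalPair x y) N).symm
  rcases le_total N.sum.2.1 N.sum.1 with hc | hc
  · refine ⟨_, h₁, ?_⟩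
    rw [hsum, hsum]
    obtain ⟨d, hd⟩ := Nat.exists_eq_add_of_le hc
    rw [hd]
    nlinarith [Nat.mul_le_mul_left N.sum.2.1 huv, Nat.mul_le_mul_left d hu]
  · refine ⟨_, h₂, ?_⟩
    rw [hsum, hsum]
    obtain ⟨d, hd⟩ := Nat.exists_eq_add_of_le hc
    rw [hd]
    nlinarith [Nat.mul_le_mul_left N.sum.1 huv, Nat.mul_le_mul_left d hv]

theorem Multiset.exists_cons_forall_le {S : Multiset ℕ} (hS : S ≠ 0) :
    ∃ m R, S = m ::ₘ R ∧ ∀ r ∈ R, m ≤ r := by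
  obtain ⟨x, hx⟩ := Multiset.exists_mem_of_ne_zero hS
  obtain ⟨m, hm, hmin⟩ := S.toFinset.exists_min_image id ⟨x, Multiset.mem_toFinset.2 hx⟩
  obtain ⟨R, rfl⟩ := Multiset.exists_cons_of_mem (Multiset.mem_toFinset.1 hm)
  exact ⟨m, R, rfl, fun r hr =>
    hmin r (Multiset.mem_toFinset.2 (Multiset.mem_cons_of_mem hr))⟩

/-- Combining the two smallest elements first is at least as good as any other `k + 1` moves. -/
def GreedyFirst (k : ℕ) : Prop :=
  ∀ (a b : ℕ) (X T : Multiset ℕ), a ≤ b → (∀ x ∈ X, b ≤ x) → ReachIn (k + 1) (a ::ₘ b ::ₘ X) T →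
    ∃ T', ReachIn k ((a + b) ::ₘ (a + b) ::ₘ X) T' ∧ T'.sum ≤ T.sum

/-- A first move using only one of the two smallest elements can be improved. -/
theorem exists_sum_le_of_move_one_smallest {k c d x : ℕ} {R T : Multiset ℕ}
    (ih : ∀ j < k, GreedyFirst j) (hcx : c ≤ x) (hdx : d ≤ x)
    (hcR : ∀ r ∈ R, c ≤ r) (hdR : ∀ r ∈ R, d ≤ r)
    (h : ReachIn k ((c + x) ::ₘ (c + x) ::ₘ d ::ₘ R) T) :
    ∃ T', ReachIn k ((c + d) ::ₘ (c + d) ::ₘ x ::ₘ R) T' ∧ T'.sum ≤ T.sum := by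
  cases k with
  | zero =>
    obtain rfl : T = _ := h
    refine ⟨_, rfl, ?_⟩
    simp only [Multiset.sum_cons]
    omega
  | succ k =>
    obtain ⟨m, Y, hY, hm⟩ := Multiset.exists_cons_forall_le
      (Multiset.cons_ne_zero : (c + x) ::ₘ (c + x) ::ₘ R ≠ 0)
    have hdm : d ≤ m := by
      have : m ∈ (c + x) ::ₘ (c + x) ::ₘ R := hY ▸ Multiset.mem_cons_self m Y
      simp only [Multiset.mem_cons] at this
      rcases this with rfl | rfl | hmR
      · omega
      · omega
      · exact hdR m hmR
    have hconf : (c + x) ::ₘ (c + x) ::ₘ d ::ₘ R = d ::ₘ m ::ₘ Y := by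
      rw [← hY, Multiset.cons_swap (c + x) d, Multiset.cons_swap (c + x) d]
    rw [hconf] at h
    obtain ⟨T₁, h₁, hT₁⟩ := ih k (Nat.lt_succ_self k) d m Y T hdm hm h
    by_cases hmx : m = c + x
    · subst hmx
      obtain rfl := (Multiset.cons_inj_right _).1 hY
      have e (y : ℕ) : (d + (c + x)) ::ₘ (d + (c + x)) ::ₘ y ::ₘ R
          = y ::ₘ (d + (c + x)) ::ₘ (d + (c + x)) ::ₘ R := by
        simp only [← Multiset.singleton_add]; abel
      rw [e] at h₁
      obtain ⟨T₂, h₂, hT₂⟩ := ReachIn.exists_sum_le (u := c + d) (v := d + (c + x)) h₁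
        (by omega) (by omega) (by omega)
      refine ⟨T₂, ⟨_, ⟨c + d, x, (c + d) ::ₘ R, by rw [Multiset.cons_swap x], rfl⟩, ?_⟩,
        hT₂.trans hT₁⟩
      rw [show c + d + x = d + (c + x) by omega, e]
      exact h₂
    · have hYR : ∃ Q, R = m ::ₘ Q ∧ Y = (c + x) ::ₘ (c + x) ::ₘ Q := by
        have : m ∈ (c + x) ::ₘ (c + x) ::ₘ R := hY ▸ Multiset.mem_cons_self m Y
        simp only [Multiset.mem_cons, hmx, false_or] at this
        obtain ⟨Q, rfl⟩ := Multiset.exists_cons_of_mem this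
        refine ⟨Q, rfl, ?_⟩
        rw [Multiset.cons_swap (c + x) m, Multiset.cons_swap (c + x) m] at hY
        exact ((Multiset.cons_inj_right _).1 hY).symm
      obtain ⟨Q, rfl, rfl⟩ := hYR
      have hcm : c ≤ m := hcR m (Multiset.mem_cons_self m Q)
      have e₁ : (d + m) ::ₘ (d + m) ::ₘ (c + x) ::ₘ (c + x) ::ₘ Q
          = (d + m) ::ₘ (c + x) ::ₘ (d + m) ::ₘ (c + x) ::ₘ Q := by
        rw [Multiset.cons_swap (d + m) (c + x)]
      rw [e₁] at h₁
      obtain ⟨T₂, h₂, hT₂⟩ := ReachIn.exists_sum_le (u := c + d) (v := x + m) h₁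
        (by omega) (by omega) (by omega)
      have e₂ : (c + d) ::ₘ (x + m) ::ₘ (d + m) ::ₘ (c + x) ::ₘ Q
          = (d + m) ::ₘ (c + x) ::ₘ (c + d) ::ₘ (x + m) ::ₘ Q := by
        simp only [← Multiset.singleton_add]; abel
      rw [e₂] at h₂
      obtain ⟨T₃, h₃, hT₃⟩ := ReachIn.exists_sum_le (u := c + d) (v := x + m) h₂
        (by omega) (by omega) (by omega)
      refine ⟨T₃, ⟨_, ⟨x, m, (c + d) ::ₘ (c + d) ::ₘ Q, ?_, rfl⟩, ?_⟩,
        hT₃.trans (hT₂.trans hT₁)⟩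
      · simp only [← Multiset.singleton_add]; abel
      · convert h₃ using 1
        simp only [← Multiset.singleton_add]; abel

theorem greedyFirst (k : ℕ) : GreedyFirst k := by
  induction k using Nat.strong_induction_on with
  | _ k ih =>
    rintro a b X T hab hbX ⟨U, ⟨p, q, S, hS, rfl⟩, h⟩
    have use_a {x : ℕ} {R : Multiset ℕ} (hX : X = x ::ₘ R)
        (h : ReachIn k ((a + x) ::ₘ (a + x) ::ₘ b ::ₘ R) T) :
        ∃ T', ReachIn k ((a + b) ::ₘ (a + b) ::ₘ X) T' ∧ T'.sum ≤ T.sum := by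
      subst hX
      have hx := hbX x (Multiset.mem_cons_self x R)
      have hR (r) (hr : r ∈ R) := hbX r (Multiset.mem_cons_of_mem hr)
      exact exists_sum_le_of_move_one_smallest ih (hab.trans hx) hx
        (fun r hr => hab.trans (hR r hr)) hR h
    have use_b {x : ℕ} {R : Multiset ℕ} (hX : X = x ::ₘ R)
        (h : ReachIn k ((b + x) ::ₘ (b + x) ::ₘ a ::ₘ R) T) :
        ∃ T', ReachIn k ((a + b) ::ₘ (a + b) ::ₘ X) T' ∧ T'.sum ≤ T.sum := by
      subst hX
      have hx := hbX x (Multiset.mem_cons_self x R)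
      have hR (r) (hr : r ∈ R) := hbX r (Multiset.mem_cons_of_mem hr)
      rw [add_comm a b]
      exact exists_sum_le_of_move_one_smallest ih hx (hab.trans hx) hR
        (fun r hr => hab.trans (hR r hr)) h
    rcases Multiset.cons_eq_cons.1 hS with ⟨rfl, hB⟩ | ⟨-, C, hC, hC'⟩
    · rcases Multiset.cons_eq_cons.1 hB with ⟨rfl, rfl⟩ | ⟨-, R, hX, rfl⟩
      · exact ⟨T, h, le_rfl⟩
      · exact use_a hX h
    · rcases Multiset.cons_eq_cons.1 hC' with ⟨rfl, rfl⟩ | ⟨-, D, rfl, rfl⟩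
      · rw [add_comm p q] at h
        rcases Multiset.cons_eq_cons.1 hC with ⟨rfl, rfl⟩ | ⟨-, R, hX, rfl⟩
        · exact ⟨T, h, le_rfl⟩
        · exact use_a hX h
      · rcases Multiset.cons_eq_cons.1 hC with ⟨rfl, hX⟩ | ⟨-, E, hX, hE⟩
        · exact use_b hX h
        · rcases Multiset.cons_eq_cons.1 hE with ⟨rfl, rfl⟩ | ⟨-, F, rfl, rfl⟩
          · rw [add_comm p q] at h
            exact use_b hX h
          · subst hX
            have hp := hbX p (by simp)
            have hq := hbX q (by simp)
            cases k with
            | zero =>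
              obtain rfl : T = _ := h
              refine ⟨_, rfl, ?_⟩
              simp only [Multiset.sum_cons]
              omega
            | succ k =>
              have e : (p + q) ::ₘ (p + q) ::ₘ a ::ₘ b ::ₘ F
                  = a ::ₘ b ::ₘ (p + q) ::ₘ (p + q) ::ₘ F := by
                simp only [← Multiset.singleton_add]; abel
              rw [e] at h
              have hF : ∀ x ∈ (p + q) ::ₘ (p + q) ::ₘ F, b ≤ x := by
                intro x hx
                simp only [Multiset.mem_cons] at hx
                rcases hx with rfl | rfl | hx
                · omega
                · omega
                · exact hbX x (by simp [hx])
              obtain ⟨T', h', hT'⟩ := ih k (Nat.lt_succ_self k) a b _ T hab hF h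
              refine ⟨T', ⟨_, ⟨p, q, (a + b) ::ₘ (a + b) ::ₘ F, ?_, rfl⟩, ?_⟩, hT'⟩
              · simp only [← Multiset.singleton_add]; abel
              · convert h' using 1
                simp only [← Multiset.singleton_add]; abel

theorem exists_reachIn_cons_cons (k a b : ℕ) (X : Multiset ℕ) :
    ∃ T, ReachIn k (a ::ₘ b ::ₘ X) T := by
  induction k generalizing a b with
  | zero => exact ⟨_, rfl⟩
  | succ k ih =>
    obtain ⟨T, hT⟩ := ih (a + b) (a + b)
    exact ⟨T, (a + b) ::ₘ (a + b) ::ₘ X, ⟨a, b, X, rfl, rfl⟩, hT⟩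

/-- Let `k ≥ 1` and let `S = {s₁, s₂, …, s_n}` be a starting configuration of positive
integers with `s₁ ≤ s₂ ≤ … ≤ s_n` (here `s₁ = a`, `s₂ = b`, and `X = {s₃, …, s_n}`).
Then combining the two smallest elements is an optimal first move:
`opt ({s₁+s₂, s₁+s₂, s₃, …, s_n}) (k-1) = opt S k`. -/
theorem opt_first_move_two_smallest (k : ℕ) (hk : 1 ≤ k)
    (a b : ℕ) (X : Multiset ℕ)
    (ha : 0 < a) (hab : a ≤ b) (hbX : ∀ x ∈ X, b ≤ x) :
    opt ((a + b) ::ₘ (a + b) ::ₘ X) (k - 1) = opt (a ::ₘ b ::ₘ X) k := by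
  obtain ⟨k, rfl⟩ := Nat.exists_eq_add_of_le' hk
  rw [Nat.add_sub_cancel]
  apply le_antisymm
  · obtain ⟨T₀, hT₀⟩ := exists_reachIn_cons_cons (k + 1) a b X
    refine le_csInf ⟨_, T₀, hT₀, rfl⟩ ?_
    rintro _ ⟨T, hT, rfl⟩
    obtain ⟨T', hT', hle⟩ := greedyFirst k a b X T hab hbX hT
    exact le_trans (Nat.sInf_le ⟨T', hT', rfl⟩) hle
  · obtain ⟨T₀, hT₀⟩ := exists_reachIn_cons_cons k (a + b) (a + b) X
    refine le_csInf ⟨_, T₀, hT₀, rfl⟩ ?_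
    rintro _ ⟨T, hT, rfl⟩
    exact Nat.sInf_le ⟨T, ⟨_, ⟨a, b, X, rfl, rfl⟩, hT⟩, rfl⟩
end

section
/- Let G be a finite simple graph on n vertices with an edge-labelling φ : E(G) → ℝ. If the total number of nice walks in G (over all lengths t ≥ 0, where each single vertex counts as a nice 0-walk) is larger than n², then φ is not a good edge-labelling. -/
/-- An edge-labelling `φ` of a simple graph `G` is *good* if for every ordered pair of
vertices `(u, v)` there is at most one path from `u` to `v` along which the edge labels
are nondecreasing. -/
def GoodLabelling {V : Type*} (G : SimpleGraph V) (φ : Sym2 V → ℝ) : Prop :=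
  ∀ (u v : V) (p q : G.Walk u v), p.IsPath → q.IsPath →
    (p.edges.map φ).Chain' (· ≤ ·) → (q.edges.map φ).Chain' (· ≤ ·) → p = q

/-- A graph is *good* if it admits a good edge-labelling. -/
def IsGoodGraph {V : Type*} (G : SimpleGraph V) : Prop :=
  ∃ φ : Sym2 V → ℝ, GoodLabelling G φ
/-- A *nice walk* in `G` (with edge-labelling `φ`), recorded as its (nonempty) list of
vertices `v₀ v₁ … v_t`: consecutive vertices are adjacent, there is no immediate
backtracking (`v_{i-1} ≠ v_{i+1}`), and the labels of consecutive edges are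
nondecreasing (`φ(v_{i-1}v_i) ≤ φ(v_i v_{i+1})`).  A single vertex is a nice `0`-walk. -/
def IsNiceWalk {V : Type*} (G : SimpleGraph V) (φ : Sym2 V → ℝ) (p : List V) : Prop :=
  p ≠ [] ∧ p.Chain' G.Adj ∧
    ∀ (i : ℕ) (h : i + 2 < p.length),
      p[i] ≠ p[i + 2] ∧ φ s(p[i], p[i + 1]) ≤ φ s(p[i + 1], p[i + 2])

theorem IsNiceWalk.of_cons {V : Type*} {G : SimpleGraph V} {φ : Sym2 V → ℝ} {a b : V}
    {l : List V} (h : IsNiceWalk G φ (a :: b :: l)) : IsNiceWalk G φ (b :: l) := by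
  obtain ⟨-, hadj, hnice⟩ := h
  refine ⟨List.cons_ne_nil _ _, hadj.tail, fun i hi => ?_⟩
  exact hnice (i + 1) (by simpa using hi)

theorem IsNiceWalk.of_append_left {V : Type*} {G : SimpleGraph V} {φ : Sym2 V → ℝ}
    {l₁ l₂ : List V} (h : IsNiceWalk G φ (l₁ ++ l₂)) (hne : l₁ ≠ []) : IsNiceWalk G φ l₁ := by
  obtain ⟨-, hadj, hnice⟩ := h
  refine ⟨hne, (List.isChain_append.mp hadj).1, fun i hi => ?_⟩
  have := hnice i (by rw [List.length_append]; omega)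
  rwa [List.getElem_append_left, List.getElem_append_left, List.getElem_append_left] at this

/-- A nice walk is the support of a walk with nondecreasing edge labels. -/
theorem IsNiceWalk.exists_walk {V : Type*} {G : SimpleGraph V} {φ : Sym2 V → ℝ} {a : V}
    {l : List V} (h : IsNiceWalk G φ (a :: l)) :
    ∃ (v : V) (w : G.Walk a v), w.support = a :: l ∧ (w.edges.map φ).IsChain (· ≤ ·) := by
  induction l generalizing a with
  | nil => exact ⟨a, .nil, by simp, by simp⟩
  | cons b l ih =>
    obtain ⟨v, w, hsupp, hchain⟩ := ih h.of_cons
    have hab : G.Adj a b := (List.isChain_cons_cons.mp h.2.1).1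
    refine ⟨v, .cons hab w, by simp [hsupp], ?_⟩
    cases w with
    | nil => simp
    | cons hbc w =>
      cases l with
      | nil => simp at hsupp
      | cons c l =>
        have hc := (List.cons.inj ((w.cons_tail_support).trans (List.cons.inj hsupp).2)).1
        subst hc
        have hle := (h.2.2 0 (by simp)).2
        simp only [SimpleGraph.Walk.edges_cons, List.map_cons] at hchain ⊢
        exact List.isChain_cons_cons.mpr ⟨hle, hchain⟩

theorem GoodLabelling.nodup_of_isNiceWalk {V : Type*} {G : SimpleGraph V} {φ : Sym2 V → ℝ}
    (hφ : GoodLabelling G φ) {p : List V} (hp : IsNiceWalk G φ p) : p.Nodup := by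
  induction p with
  | nil => exact List.nodup_nil
  | cons a l ih =>
    cases l with
    | nil => simp
    | cons b l =>
      have hl := ih hp.of_cons
      refine List.nodup_cons.mpr ⟨fun ha => ?_, hl⟩
      obtain ⟨l₁, l₂, hsplit⟩ := List.append_of_mem ha
      rw [hsplit] at hp hl
      have hnodup : (a :: l₁).Nodup :=
        (List.nodup_middle.mp hl).sublist ((List.sublist_append_left l₁ l₂).cons_cons a)
      rw [← List.cons_append] at hp
      obtain ⟨v, w, hsupp, hchain⟩ := (hp.of_append_left (List.cons_ne_nil _ _)).exists_walk
      have hlast : v ∈ (a :: l₁).getLast? := by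
        rw [← hsupp, List.getLast?_eq_some_getLast w.support_ne_nil,
          SimpleGraph.Walk.getLast_support]
        rfl
      have hva : G.Adj v a := (List.isChain_append.mp hp.2.1).2.2 v hlast a (by simp)
      have hw := hφ a v w hva.symm.toWalk (.mk' (hsupp ▸ hnodup))
        (SimpleGraph.Walk.IsPath.of_adj hva.symm) hchain (List.isChain_singleton _)
      subst hw
      have hl₁ : l₁ = [v] := by simpa using hsupp.symm
      subst hl₁
      exact (hp.2.2 0 (by simp)).1 rfl

/-- If a graph on `n` vertices has more than `n²` nice walks (over all lengths `t ≥ 0`,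
a single vertex counting as a nice `0`-walk), then the edge-labelling is not good. -/
theorem not_goodLabelling_of_many_niceWalks {V : Type*} [Fintype V]
    (G : SimpleGraph V) (φ : Sym2 V → ℝ) (s : Finset (List V))
    (hs : ∀ p ∈ s, IsNiceWalk G φ p) (hcard : Fintype.card V ^ 2 < s.card) :
    ¬ GoodLabelling G φ := by
  intro hφ
  have hwalk : ∀ p : s, ∃ (u v : V) (w : G.Walk u v),
      w.support = p ∧ w.IsPath ∧ (w.edges.map φ).IsChain (· ≤ ·) := by
    rintro ⟨p, hp⟩
    have hnice := hs p hp
    obtain ⟨u, l, rfl⟩ := List.exists_cons_of_ne_nil hnice.1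
    obtain ⟨v, w, hsupp, hchain⟩ := hnice.exists_walk
    exact ⟨u, v, w, hsupp, .mk' (hsupp ▸ hφ.nodup_of_isNiceWalk hnice), hchain⟩
  choose f g w hsupp hpath hchain using hwalk
  have hinj : Function.Injective fun p => (f p, g p) := by
    intro p q hpq
    obtain ⟨hf, hg⟩ := Prod.mk.inj hpq
    have hw : (w p).copy hf hg = w q :=
      hφ _ _ _ _ (by simpa using hpath p) (hpath q) (by rw [SimpleGraph.Walk.edges_copy]; exact hchain p) (hchain q)
    apply Subtype.ext
    rw [← hsupp p, ← hsupp q, ← hw, SimpleGraph.Walk.support_copy]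
  have hle := Fintype.card_le_of_injective _ hinj
  rw [Fintype.card_coe, Fintype.card_prod, ← sq] at hle
  exact hcard.not_ge hle
end
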